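/- Every simple graph G with crossing number cr(G) ≤ 10 is biplanar, i.e., cr_2(G) = 0. -/

import Mathlib

open SimpleGraph

/-- A drawing of a simple graph `G` in the plane: an injective placement of the
vertices, together with, for each (oriented) edge, a simple arc between the images
of its endpoints that avoids all vertex images in its interior; the two
orientations of an edge are drawn by the same arc (reversed). -/
structure Drawing {V : Type*} (G : SimpleGraph V) where
  pos : V → ℝ × ℝ
  pos_inj : Function.Injective pos
  arc : ∀ ⦃u v : V⦄, G.Adj u v → Path (pos u) (pos v)
  arc_symm : ∀ ⦃u v : V⦄ (h : G.Adj u v), arc h.symm = (arc h).symm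
  arc_inj : ∀ ⦃u v : V⦄ (h : G.Adj u v), Function.Injective (arc h)
  arc_avoid : ∀ ⦃u v : V⦄ (h : G.Adj u v) (w : V) (t : unitInterval),
    arc h t = pos w → t = 0 ∨ t = 1

/-- The interior of the curve representing an edge `e` in a drawing:
the image of the open arc, excluding the endpoints. -/
def Drawing.edgeInterior {V : Type*} {G : SimpleGraph V} (D : Drawing G) (e : Sym2 V) :
    Set (ℝ × ℝ) :=
  ⋃ (u : V) (v : V) (h : G.Adj u v) (_ : e = s(u, v)),
    (D.arc h) '' {t : unitInterval | t ≠ 0 ∧ t ≠ 1}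

/-- Two edges of `G` cross in the drawing `D` if they are distinct edges of `G`
whose interiors meet. -/
def Drawing.Crosses {V : Type*} {G : SimpleGraph V} (D : Drawing G) (e f : Sym2 V) : Prop :=
  e ∈ G.edgeSet ∧ f ∈ G.edgeSet ∧ e ≠ f ∧ (D.edgeInterior e ∩ D.edgeInterior f).Nonempty

/-- The number of crossings of a drawing: the number of unordered pairs of
distinct edges that cross (in a simple/nice drawing every crossing pair of edges
crosses exactly once). -/
noncomputable def Drawing.crossCount {V : Type*} {G : SimpleGraph V} (D : Drawing G) : ℕ :=
  {p : Sym2 V × Sym2 V | D.Crosses p.1 p.2}.ncard / 2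

/-- The crossing number `cr(G)`: the minimum number of crossings over all drawings
of `G` in the plane. -/
noncomputable def crossingNumber {V : Type*} (G : SimpleGraph V) : ℕ :=
  sInf {n : ℕ | ∃ D : Drawing G, D.crossCount = n}

/-- The `k`-planar crossing number `cr_k(G)`: the minimum of
`cr(G₁) + ⋯ + cr(G_k)` over all decompositions of the edge set of `G` into `k`
edge-disjoint subgraphs `G₁, …, G_k` on the same vertex set. -/
noncomputable def kCrossingNumber {V : Type*} (k : ℕ) (G : SimpleGraph V) : ℕ :=
  sInf {n : ℕ | ∃ f : Fin k → SimpleGraph V,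
    (⨆ i, f i) = G ∧
    (∀ i j : Fin k, i ≠ j → Disjoint (f i).edgeSet (f j).edgeSet) ∧
    n = ∑ i : Fin k, crossingNumber (f i)}

/-- A graph is planar if it has a drawing without crossings. -/
def IsPlanarGraph {V : Type*} (G : SimpleGraph V) : Prop :=
  ∃ D : Drawing G, ∀ e f, ¬ D.Crosses e f

/-- The drawing with the vertices on the `x`-axis, at abscissas `f`, in which the edge `e` is a
parabola scaled by the factor `σ e`. -/
noncomputable def parabolaDrawing {V : Type*} (G : SimpleGraph V) (f : V → ℝ)
    (hf : Function.Injective f) (σ : Sym2 V → ℝ) (hσ : ∀ e, σ e ≠ 0) : Drawing G where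
  pos v := (f v, 0)
  pos_inj u v h := hf (Prod.ext_iff.1 h).1
  arc u v _ :=
    { toFun := fun t => (f u + t * (f v - f u), σ s(u, v) * ((t * (1 - t)) * (f v - f u) ^ 2))
      continuous_toFun := by fun_prop
      source' := by simp
      target' := by simp }
  arc_symm u v h := by
    ext t
    · simp [Path.symm]; ring
    · simp only [Path.symm, Path.coe_mk_mk, Function.comp, unitInterval.coe_symm_eq,
        Sym2.eq_swap (a := v)]
      ring
  arc_inj u v h s t hst := by
    have h1 := (Prod.ext_iff.1 hst).1
    have h2 : f v - f u ≠ 0 := sub_ne_zero.2 fun e => h.ne (hf e).symm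
    exact Subtype.ext (by simpa [h2] using h1)
  arc_avoid u v h w t ht := by
    have h1 := (Prod.ext_iff.1 ht).2
    have h2 : f v - f u ≠ 0 := sub_ne_zero.2 fun e => h.ne (hf e).symm
    simp only [Path.coe_mk_mk, mul_eq_zero, hσ, pow_eq_zero_iff, ne_eq, OfNat.ofNat_ne_zero,
      not_false_eq_true, h2, or_false, false_or, sub_eq_zero] at h1
    exact h1.imp (fun h => Subtype.ext h) (fun h => Subtype.ext h.symm)

lemma exists_of_mem_edgeInterior_parabolaDrawing {V : Type*} {G : SimpleGraph V} {f : V → ℝ}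
    {hf : Function.Injective f} {σ : Sym2 V → ℝ} {hσ : ∀ e, σ e ≠ 0} {e : Sym2 V} {p : ℝ × ℝ}
    (hp : p ∈ (parabolaDrawing G f hf σ hσ).edgeInterior e) :
    ∃ u v, G.Adj u v ∧ e = s(u, v) ∧ f u < p.1 ∧ p.1 < f v ∧
      p.2 = σ e * ((p.1 - f u) * (f v - p.1)) := by
  simp only [Drawing.edgeInterior, Set.mem_iUnion, Set.mem_image] at hp
  obtain ⟨u, v, h, he, t, ⟨ht0, ht1⟩, rfl⟩ := hp
  have h0 : (0 : ℝ) < t := lt_of_le_of_ne t.2.1 fun h => ht0 (Subtype.ext h.symm)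
  have h1 : (t : ℝ) < 1 := lt_of_le_of_ne t.2.2 fun h => ht1 (Subtype.ext h)
  have hX : ((parabolaDrawing G f hf σ hσ).arc h t).1 = f u + t * (f v - f u) := rfl
  have hY : ((parabolaDrawing G f hf σ hσ).arc h t).2
    = σ s(u, v) * ((t * (1 - t)) * (f v - f u) ^ 2) := rfl
  rw [hX, hY, he]
  rcases lt_or_gt_of_ne (fun e => h.ne (hf e) : f u ≠ f v) with huv | huv
  · exact ⟨u, v, h, rfl, by nlinarith, by nlinarith, by ring⟩
  · exact ⟨v, u, h.symm, Sym2.eq_swap, by nlinarith, by nlinarith, by ring⟩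

/-- A two-page book embedding gives a drawing without crossings. -/
theorem isPlanarGraph_of_two_page {V : Type*} (G : SimpleGraph V) (f : V → ℝ)
    (hf : Function.Injective f) (up : Sym2 V → Prop)
    (hup : ∀ u v w z, G.Adj u v → G.Adj w z → (up s(u, v) ↔ up s(w, z)) →
      f u < f w → f w < f v → f v < f z → False) : IsPlanarGraph G := by
  classical
  refine ⟨parabolaDrawing G f hf (fun e => if up e then 1 else -1)
    (fun e => by split_ifs <;> norm_num), fun e e' ⟨_, _, hne, p, hp, hp'⟩ => ?_⟩
  obtain ⟨a, b, hab, rfl, ha, hb, hy⟩ := exists_of_mem_edgeInterior_parabolaDrawing hp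
  obtain ⟨c, d, hcd, rfl, hc, hd, hy'⟩ := exists_of_mem_edgeInterior_parabolaDrawing hp'
  have h1 : 0 < (p.1 - f a) * (f b - p.1) := mul_pos (by linarith) (by linarith)
  have h2 : 0 < (p.1 - f c) * (f d - p.1) := mul_pos (by linarith) (by linarith)
  have hpage : (up s(a, b) ↔ up s(c, d)) := by
    by_cases h3 : up s(a, b) <;> by_cases h4 : up s(c, d) <;> simp [h3, h4] at hy hy' ⊢ <;>
      linarith
  have heq : (p.1 - f a) * (f b - p.1) = (p.1 - f c) * (f d - p.1) := by
    by_cases h4 : up s(c, d) <;> simp only [hpage, h4, if_true, if_false] at hy hy' <;> linarith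
  rcases lt_trichotomy (f a) (f c) with hac | hac | hac
  · rcases lt_or_ge (f b) (f d) with hbd | hbd
    · exact hup a b c d hab hcd hpage hac (by linarith) hbd
    · nlinarith
  · rcases lt_trichotomy (f b) (f d) with hbd | hbd | hbd
    · nlinarith
    · exact hne (by rw [hf hac, hf hbd])
    · nlinarith
  · rcases lt_or_ge (f d) (f b) with hbd | hbd
    · exact hup c d a b hcd hab hpage.symm hac (by linarith) hbd
    · nlinarith

/-- No two edges of `G` interleave when the vertices are placed on a line by `f`. -/
def IsNoncrossingOrder {V : Type*} (G : SimpleGraph V) (f : V → ℝ) : Prop :=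
  ∀ u v w z, G.Adj u v → G.Adj w z → f u < f w → f w < f v → f v < f z → False

lemma IsNoncrossingOrder.neg {V : Type*} {G : SimpleGraph V} {f : V → ℝ}
    (h : IsNoncrossingOrder G f) : IsNoncrossingOrder G (-f) := fun _ _ _ _ huv hwz h1 h2 h3 => by
  simp only [Pi.neg_apply, neg_lt_neg_iff] at h1 h2 h3
  exact h _ _ _ _ hwz.symm huv.symm h3 h2 h1

lemma exists_gt_forall_lt {V : Type*} [Finite V] (f : V → ℝ) (x : ℝ) :
    ∃ y, x < y ∧ ∀ w, x < f w → y < f w := by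
  have h : ∀ᶠ y in nhdsWithin x (Set.Ioi x), ∀ w, x < f w → y < f w := by
    rw [Filter.eventually_all]
    intro w
    by_cases hw : x < f w
    · filter_upwards [Ioo_mem_nhdsGT hw] with y hy _ using hy.2
    · exact Filter.Eventually.of_forall fun _ h => absurd h hw
  obtain ⟨y, hy, hy'⟩ := (h.and self_mem_nhdsWithin).exists
  exact ⟨y, hy', hy⟩

/-- The graph obtained from `G` by deleting `v` and joining its neighbours. -/
def bypass {V : Type*} (G : SimpleGraph V) (v : V) : SimpleGraph V where
  Adj u w := u ≠ v ∧ w ≠ v ∧ (G.Adj u w ∨ u ≠ w ∧ G.Adj v u ∧ G.Adj v w)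
  symm := ⟨fun _ _ ⟨h1, h2, h3⟩ => ⟨h2, h1, h3.imp (·.symm) fun ⟨h, h', h''⟩ => ⟨h.symm, h'', h'⟩⟩⟩
  loopless := ⟨fun u ⟨_, _, h3⟩ => h3.elim (G.loopless.irrefl u) fun h => h.1 rfl⟩

/-- A vertex `v` of degree at most two can be inserted immediately to the right of a neighbour `p`
if the other edges at `p` leave room for the edge from `v` to its other neighbour `q`. -/
lemma IsNoncrossingOrder.insert_right {V : Type*} [DecidableEq V] {G : SimpleGraph V} {v p q : V}
    {f : V → ℝ} (h : IsNoncrossingOrder (bypass G v) f) (hf : Function.Injective f)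
    {y : ℝ} (hy : f p < y) (hy' : ∀ w, f p < f w → y < f w)
    (hvp : G.Adj v p) (hvq : ∀ x, G.Adj v x → x = p ∨ x = q)
    (hp : ∀ c, G.Adj p c → c ≠ v → f p < f c → f c < f q → False)
    (hqp : ∀ c, G.Adj p c → c ≠ v → c ≠ q → f q < f p → f q < f c ∧ f c < f p) :
    IsNoncrossingOrder G (Function.update f v y) := by
  have hlt : ∀ w, f w < y ↔ w = p ∨ f w < f p := fun w => by
    constructor
    · intro hw
      rcases lt_trichotomy (f p) (f w) with h1 | h1 | h1
      · linarith [hy' w h1]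
      · exact .inl (hf h1.symm)
      · exact .inr h1
    · rintro (rfl | h1)
      · exact hy
      · linarith
  have hgt : ∀ w, y < f w ↔ f p < f w := fun w => ⟨fun h1 => by linarith, hy' w⟩
  intro a b c d hab hcd h1 h2 h3
  have hv := G.loopless.irrefl v
  have key := h a b c d
  have k1 := h p q c d
  have k2 := h a b p q
  have k3 := h q p c d
  have k4 := h a b q p
  simp only [bypass] at key k1 k2 k3 k4
  simp only [Function.update_apply] at h1 h2 h3
  by_cases ha : a = v <;> by_cases hb : b = v <;> by_cases hc : c = v <;> by_cases hd : d = v <;>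
    simp only [ha, hb, hc, hd, if_true, if_false, hlt, hgt] at h1 h2 h3 <;> grind [G.adj_comm]

lemma exists_isNoncrossingOrder {V : Type*} [Finite V] (S : Finset V) : ∀ G : SimpleGraph V,
    (∀ u w, G.Adj u w → u ∈ S) →
    (∀ u x y z, G.Adj u x → G.Adj u y → G.Adj u z → x = y ∨ y = z ∨ x = z) →
    ∃ f : V → ℝ, Function.Injective f ∧ IsNoncrossingOrder G f := by
  classical
  induction S using Finset.induction_on with
  | empty =>
    intro G hG _
    obtain ⟨n, ⟨e⟩⟩ := Finite.exists_equiv_fin V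
    exact ⟨fun v => ((e v : ℕ) : ℝ), fun u v h => e.injective (Fin.ext (Nat.cast_injective h)),
      fun u v w z h => absurd (hG u v h) (by simp)⟩
  | insert v S hv ih =>
    intro G hG hdeg
    obtain ⟨f, hf, hnc⟩ := ih (bypass G v)
      (fun u w h => by
        have := hG u w; have := hG u v
        simp only [bypass] at h
        grind [G.adj_comm])
      (fun u x y z => by
        have h1 := hdeg u; have h2 := hdeg v; simp only [bypass]
        grind [G.adj_comm])
    by_cases hiso : ∃ p, G.Adj v p
    · have main : ∀ f : V → ℝ, Function.Injective f → IsNoncrossingOrder (bypass G v) f →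
          ∀ p q, G.Adj v p → G.Adj v q → (∀ x, G.Adj v x → x = p ∨ x = q) → f p ≤ f q →
          ∃ g : V → ℝ, Function.Injective g ∧ IsNoncrossingOrder G g := by
        intro f hf hnc p q hvp hvq hx hpq
        have hinj : ∀ g : V → ℝ, Function.Injective g → ∀ y, g p < y → (∀ w, g p < g w → y < g w) →
            Function.Injective (Function.update g v y) := fun g hg y hy hy' a b hab => by
          have := @hg a b
          simp only [Function.update_apply] at hab
          grind
        by_cases hc : ∃ c, G.Adj p c ∧ c ≠ v ∧ f p < f c ∧ f c < f q
        · obtain ⟨y, hy, hy'⟩ := exists_gt_forall_lt (-f) (-f p)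
          refine ⟨_, hinj _ (neg_injective.comp hf) y hy hy',
            IsNoncrossingOrder.insert_right (q := q) hnc.neg (neg_injective.comp hf) hy hy' hvp hx
              ?_ ?_⟩
          · intro c _ _ h1 h2
            simp only [Pi.neg_apply] at h1 h2
            linarith
          · intro c' _ _ _ _
            obtain ⟨c, _, _, _, _⟩ := hc
            have := hdeg p c c' v
            simp only [Pi.neg_apply]
            grind [G.adj_comm]
        · obtain ⟨y, hy, hy'⟩ := exists_gt_forall_lt f (f p)
          refine ⟨_, hinj _ hf y hy hy', hnc.insert_right (q := q) hf hy hy' hvp hx ?_ ?_⟩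
          · exact fun c h1 h2 h3 h4 => hc ⟨c, h1, h2, h3, h4⟩
          · exact fun c _ _ _ h => absurd hpq (not_le.2 h)
      obtain ⟨p, hp⟩ := hiso
      by_cases hq : ∃ q, G.Adj v q ∧ q ≠ p
      · obtain ⟨q, hq, hqp⟩ := hq
        have hx : ∀ x, G.Adj v x → x = p ∨ x = q := fun x hx => by
          have := hdeg v x p q hx hp hq
          grind
        rcases le_total (f p) (f q) with h | h
        · exact main f hf hnc p q hp hq hx h
        · exact main f hf hnc q p hq hp (fun x h' => (hx x h').symm) h
      · exact main f hf hnc p p hp hp (fun x hx => .inl (by grind)) le_rfl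
    · refine ⟨f, hf, fun a b c d hab hcd => hnc a b c d ?_ ?_⟩ <;> simp only [bypass] <;>
        grind [G.adj_comm]

/-- A graph with maximum degree at most two after the removal of one vertex is planar. -/
lemma isPlanarGraph_of_deleteIncidenceSet {V : Type*} [Finite V] (G : SimpleGraph V) (a : V)
    (h : ∀ u x y z, (G.deleteIncidenceSet a).Adj u x → (G.deleteIncidenceSet a).Adj u y →
      (G.deleteIncidenceSet a).Adj u z → x = y ∨ y = z ∨ x = z) : IsPlanarGraph G := by
  cases nonempty_fintype V
  obtain ⟨f, hf, hnc⟩ := exists_isNoncrossingOrder Finset.univ (G.deleteIncidenceSet a) (by simp) h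
  refine isPlanarGraph_of_two_page G f hf (a ∈ ·) fun u v w z huv hwz hup h1 h2 h3 => ?_
  have := hnc u v w z
  simp only [deleteIncidenceSet_adj, Sym2.mem_iff] at this hup
  grind

/-- Let `f` place the vertices of `G` on a line. If every edge meets `a` or `b`, joins consecutive
vertices, or is the edge from `s` to `t`, and if no edge at `a` ends between `s` and `t`, then
`G` is planar. -/
lemma isPlanarGraph_of_two_stars {V : Type*} (G : SimpleGraph V) (f : V → ℤ)
    (hf : Function.Injective f) (a b s t : V) (hst : f s ≤ f t)
    (hE : ∀ u v, G.Adj u v → u ≠ a → v ≠ a → u ≠ b → v ≠ b →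
      f v = f u + 1 ∨ f u = f v + 1 ∨ (u = s ∧ v = t) ∨ (u = t ∧ v = s))
    (hm : ∀ m, f s < f m → f m < f t → m ≠ a ∧ ¬ G.Adj a m) : IsPlanarGraph G := by
  refine isPlanarGraph_of_two_page G (fun v => (f v : ℝ)) (Int.cast_injective.comp hf)
    (fun e => a ∈ e ∨ e = s(s, t)) fun u v w z huv hwz hup h1 h2 h3 => ?_
  simp only [Int.cast_lt] at h1 h2 h3
  have e1 : (a = u ∨ a = v) ∨ (b = u ∨ b = v) ∨ (u = s ∧ v = t) ∨ (u = t ∧ v = s) := by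
    have := hE u v huv
    grind
  have e2 : (a = w ∨ a = z) ∨ (b = w ∨ b = z) ∨ (w = s ∧ z = t) ∨ (w = t ∧ z = s) := by
    have := hE w z hwz
    grind
  have hv := hm v
  have hw := hm w
  have := huv.symm
  have := hwz.symm
  clear hE hm
  simp only [Sym2.mem_iff, Sym2.eq_iff] at hup
  rcases e1 with e1 | e1 | e1 | e1 <;> rcases e2 with e2 | e2 | e2 | e2 <;> grind

lemma exists_injective_of_nodup {V : Type*} [Finite V] (l : List V) (hl : l.Nodup) :
    ∃ f : V → ℤ, Function.Injective f ∧ ∀ (i : ℕ) (hi : i < l.length), f l[i] = i := by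
  classical
  obtain ⟨n, ⟨e⟩⟩ := Finite.exists_equiv_fin V
  refine ⟨fun v => if v ∈ l then l.idxOf v else l.length + (e v : ℕ), fun u v h => ?_,
    fun i hi => ?_⟩
  · by_cases hu : u ∈ l <;> by_cases hv : v ∈ l <;> simp only [hu, hv, if_true, if_false] at h
    · exact (List.idxOf_inj hu).1 (by exact_mod_cast h)
    · have := List.idxOf_lt_length_of_mem hu
      omega
    · have := List.idxOf_lt_length_of_mem hv
      omega
    · exact e.injective (Fin.ext (by omega))
  · simp [hl.idxOf_getElem]

lemma exists_consecutive_of_matching {V : Type*} [Finite V] (G : SimpleGraph V)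
    (h : ∀ u x y, G.Adj u x → G.Adj u y → x = y) :
    ∃ f : V → ℤ, Function.Injective f ∧ ∀ u v, G.Adj u v → f v = f u + 1 ∨ f u = f v + 1 := by
  classical
  obtain ⟨n, ⟨e⟩⟩ := Finite.exists_equiv_fin V
  have hm : ∀ v, ∃ w, (w = v ∧ ∀ x, ¬ G.Adj v x) ∨ G.Adj v w := fun v => by
    by_cases hv : ∃ x, G.Adj v x
    · exact ⟨_, .inr hv.choose_spec⟩
    · exact ⟨v, .inl ⟨rfl, fun x hx => hv ⟨x, hx⟩⟩⟩
  choose m hm using hm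
  have hadj : ∀ u v, G.Adj u v → m u = v := fun u v huv => by
    rcases hm u with h1 | h1
    · exact absurd huv (h1.2 v)
    · exact h u _ _ h1 huv
  have hinv : ∀ v, m (m v) = v := fun v => by
    rcases hm v with h1 | h1
    · rw [h1.1, h1.1]
    · exact hadj _ _ h1.symm
  have he : ∀ u v, (e u : ℕ) = e v → u = v := fun u v h => e.injective (Fin.ext h)
  refine ⟨fun v => 2 * min (e v : ℕ) (e (m v) : ℕ) + if (e v : ℕ) ≤ e (m v) then 0 else 1,
    fun u v huv => ?_, fun u v huv => ?_⟩
  · have h1 := he u v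
    have h2 := he u (m v)
    have h3 := he (m u) v
    have h4 := he (m u) (m v)
    have := hinv u
    have := hinv v
    simp only at huv
    have key : (e u : ℕ) = e v ∨ (e u : ℕ) = e (m v) ∧ (e (m u) : ℕ) = e (m v) ∨
      (e (m u) : ℕ) = e v ∧ (e u : ℕ) = e v ∨ (e (m u) : ℕ) = e (m v) := by
      split_ifs at huv <;> omega
    grind
  · have h1 := hadj u v huv
    have h2 := hadj v u huv.symm
    have h3 : (e u : ℕ) ≠ e v := fun h => huv.ne (he _ _ h)
    simp only [h1, h2]
    split_ifs <;> omega

/-- The edges of `G` are those of the complete bipartite graph with parts `{a, b, c}` and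
`{x, y, z}`. -/
def IsThreeUtilities {V : Type*} (G : SimpleGraph V) (a b c x y z : V) : Prop :=
  [a, b, c, x, y, z].Nodup ∧ ∀ u v, G.Adj u v ↔
    (u = a ∨ u = b ∨ u = c) ∧ (v = x ∨ v = y ∨ v = z) ∨
      (u = x ∨ u = y ∨ u = z) ∧ (v = a ∨ v = b ∨ v = c)

lemma isPlanarGraph_of_path {V : Type*} [Finite V] (G : SimpleGraph V) (a b : V) (l : List V)
    (hl : l.Nodup)
    (hE : ∀ u v, G.Adj u v → u ≠ a → v ≠ a → u ≠ b → v ≠ b →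
      ∃ i, ∃ hi : i + 1 < l.length, s(u, v) = s(l[i], l[i + 1])) : IsPlanarGraph G := by
  obtain ⟨f, hf, hfl⟩ := exists_injective_of_nodup l hl
  refine isPlanarGraph_of_two_stars G f hf a b a a le_rfl (fun u v huv h1 h2 h3 h4 => ?_)
    (fun m h1 h2 => by omega)
  obtain ⟨i, hi, h⟩ := hE u v huv h1 h2 h3 h4
  have h5 := hfl i (by omega)
  have h6 := hfl (i + 1) hi
  rcases Sym2.eq_iff.1 h with ⟨rfl, rfl⟩ | ⟨rfl, rfl⟩ <;> simp [h5, h6]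

lemma isPlanarGraph_of_triangle {V : Type*} [Finite V] (G : SimpleGraph V) (a b x c y : V)
    (hl : [x, c, y].Nodup) (hca : c ≠ a) (hac : ¬ G.Adj a c)
    (hE : ∀ u v, G.Adj u v → u ≠ a → v ≠ a → u ≠ b → v ≠ b →
      s(u, v) = s(x, c) ∨ s(u, v) = s(c, y) ∨ s(u, v) = s(x, y)) : IsPlanarGraph G := by
  obtain ⟨f, hf, hfl⟩ := exists_injective_of_nodup _ hl
  have h0 := hfl 0 (by simp)
  have h1 := hfl 1 (by simp)
  have h2 := hfl 2 (by simp)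
  simp only [List.getElem_cons_zero, List.getElem_cons_succ] at h0 h1 h2
  refine isPlanarGraph_of_two_stars G f hf a b x y (by omega) (fun u v huv k1 k2 k3 k4 => ?_)
    (fun m k1 k2 => ?_)
  · have := hE u v huv k1 k2 k3 k4
    simp only [Sym2.eq_iff] at this
    grind
  · obtain rfl : m = c := hf (by omega)
    exact ⟨hca, hac⟩

lemma isPlanarGraph_of_claw {V : Type*} [Finite V] (G : SimpleGraph V) (a b c x y z : V)
    (hl : [x, c, y, z].Nodup) (hya : y ≠ a) (hay : ¬ G.Adj a y)
    (hE : ∀ u v, G.Adj u v → u ≠ a → v ≠ a → u ≠ b → v ≠ b →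
      s(u, v) = s(c, x) ∨ s(u, v) = s(c, y) ∨ s(u, v) = s(c, z)) : IsPlanarGraph G := by
  obtain ⟨f, hf, hfl⟩ := exists_injective_of_nodup _ hl
  have h0 := hfl 0 (by simp)
  have h1 := hfl 1 (by simp)
  have h2 := hfl 2 (by simp)
  have h3 := hfl 3 (by simp)
  simp only [List.getElem_cons_zero, List.getElem_cons_succ] at h0 h1 h2 h3
  refine isPlanarGraph_of_two_stars G f hf a b c z (by omega) (fun u v huv k1 k2 k3 k4 => ?_)
    (fun m k1 k2 => ?_)
  · have := hE u v huv k1 k2 k3 k4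
    simp only [Sym2.eq_iff] at this
    grind
  · obtain rfl : m = y := hf (by omega)
    exact ⟨hya, hay⟩

lemma isPlanarGraph_or_of_claw {V : Type*} [Finite V] (G : SimpleGraph V) (a b c x y w : V)
    (hcx : c ≠ x) (hcy : c ≠ y) (hcw : c ≠ w) (hxy : x ≠ y) (hxw : x ≠ w) (hyw : y ≠ w)
    (hE : ∀ u v, G.Adj u v → u ≠ a → v ≠ a → u ≠ b → v ≠ b →
      s(u, v) = s(c, x) ∨ s(u, v) = s(c, y) ∨ s(u, v) = s(c, w))
    (hxa : x ≠ a) (hya : y ≠ a) (hwa : w ≠ a) :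
    IsPlanarGraph G ∨ G.Adj a x ∧ G.Adj a y ∧ G.Adj a w := by
  by_contra! hcon
  have : ¬ G.Adj a x ∨ ¬ G.Adj a y ∨ ¬ G.Adj a w := by tauto
  apply hcon.1
  rcases this with hn | hn | hn
  · exact isPlanarGraph_of_claw G a b c y x w (by simp; grind) hxa hn
      fun u v h1 h2 h3 h4 h5 => by have := hE u v h1 h2 h3 h4 h5; tauto
  · exact isPlanarGraph_of_claw G a b c x y w (by simp; grind) hya hn
      fun u v h1 h2 h3 h4 h5 => by have := hE u v h1 h2 h3 h4 h5; tauto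
  · exact isPlanarGraph_of_claw G a b c x w y (by simp; grind) hwa hn
      fun u v h1 h2 h3 h4 h5 => by have := hE u v h1 h2 h3 h4 h5; tauto

lemma exists_eq_of_card_le_three {α : Type*} [DecidableEq α] {s : Finset α} (hs : s.card ≤ 3)
    {a b c d : α} (ha : a ∈ s) (hb : b ∈ s) (hc : c ∈ s) (hd : d ∈ s) (hab : a ≠ b)
    (hac : a ≠ c) (hbc : b ≠ c) : d = a ∨ d = b ∨ d = c := by
  have h1 : ({a, b, c} : Finset α) ⊆ s := by
    simp [Finset.insert_subset_iff, ha, hb, hc]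
  have h2 := Finset.eq_of_subset_of_card_le h1 (by
    rw [Finset.card_eq_three.2 ⟨a, b, c, hab, hac, hbc, rfl⟩]; exact hs)
  rw [← h2] at hd
  simpa using hd

/-- A graph with at most three edges outside the stars of `a` and `b` is planar, unless the
remaining edges form a triangle or a claw. -/
lemma isPlanarGraph_or_of_card_le_three {V : Type*} [Fintype V] [DecidableEq V]
    (G : SimpleGraph V) [DecidableRel G.Adj] (a b : V)
    (h : ((G.deleteIncidenceSet a).deleteIncidenceSet b).edgeFinset.card ≤ 3) :
    IsPlanarGraph G ∨ ((G.deleteIncidenceSet a).deleteIncidenceSet b).edgeFinset.card = 3 ∧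
      ∃ c x y z, [c, x, y].Nodup ∧ (∀ u v, G.Adj u v → u ≠ a → v ≠ a → u ≠ b → v ≠ b →
        s(u, v) = s(c, x) ∨ s(u, v) = s(c, y) ∨ s(u, v) = z) ∧
        ((G.deleteIncidenceSet a).deleteIncidenceSet b).Adj c x ∧
        ((G.deleteIncidenceSet a).deleteIncidenceSet b).Adj c y ∧
        z ∈ ((G.deleteIncidenceSet a).deleteIncidenceSet b).edgeSet ∧
        (z = s(x, y) ∨ ∃ w, w ≠ x ∧ w ≠ y ∧ z = s(c, w)) := by
  set H := (G.deleteIncidenceSet a).deleteIncidenceSet b with hH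
  have hadj : ∀ u v, H.Adj u v ↔ G.Adj u v ∧ u ≠ a ∧ v ≠ a ∧ u ≠ b ∧ v ≠ b := by
    simp only [hH, deleteIncidenceSet_adj]; tauto
  by_cases hmat : ∀ u x y, H.Adj u x → H.Adj u y → x = y
  · obtain ⟨f, hf, hfE⟩ := exists_consecutive_of_matching H hmat
    refine .inl (isPlanarGraph_of_two_stars G f hf a b a a le_rfl (fun u v huv h1 h2 h3 h4 => ?_)
      (fun m h1 h2 => by omega))
    have := hfE u v ((hadj u v).2 ⟨huv, h1, h2, h3, h4⟩)
    tauto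
  push Not at hmat
  obtain ⟨c, x, y, hcx, hcy, hxy⟩ := hmat
  have hne : s(c, x) ≠ s(c, y) := by rwa [ne_eq, Sym2.congr_right]
  have hncx := hcx.ne
  have hncy := hcy.ne
  by_cases h3 : ∃ e ∈ H.edgeFinset, e ≠ s(c, x) ∧ e ≠ s(c, y)
  · obtain ⟨e, he, hex, hey⟩ := h3
    have hall : ∀ u v, G.Adj u v → u ≠ a → v ≠ a → u ≠ b → v ≠ b →
        s(u, v) = s(c, x) ∨ s(u, v) = s(c, y) ∨ s(u, v) = e := fun u v huv h1 h2 h3 h4 =>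
      exists_eq_of_card_le_three h (by simpa using hcx) (by simpa using hcy) he
        (by simpa using (hadj u v).2 ⟨huv, h1, h2, h3, h4⟩) hne hex.symm hey.symm
    have hcard : H.edgeFinset.card = 3 := by
      refine le_antisymm h ?_
      rw [← Finset.card_eq_three.2 ⟨_, _, _, hne, hex.symm, hey.symm, rfl⟩]
      apply Finset.card_le_card
      simp only [Finset.insert_subset_iff, Finset.singleton_subset_iff]
      exact ⟨by simpa using hcx, by simpa using hcy, he⟩
    have aux : ∀ l : List V, l.Nodup →
        (∃ i, ∃ hi : i + 1 < l.length, s(c, x) = s(l[i], l[i + 1])) →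
        (∃ i, ∃ hi : i + 1 < l.length, s(c, y) = s(l[i], l[i + 1])) →
        (∃ i, ∃ hi : i + 1 < l.length, e = s(l[i], l[i + 1])) → IsPlanarGraph G :=
      fun l hl h1 h2 h3 => isPlanarGraph_of_path G a b l hl fun u v huv k1 k2 k3 k4 => by
        rcases hall u v huv k1 k2 k3 k4 with h | h | h <;> rw [h] <;> assumption
    have aux' : ∀ p q, (∀ l : List V, l.Nodup →
        (∃ i, ∃ hi : i + 1 < l.length, s(c, p) = s(l[i], l[i + 1])) →
        (∃ i, ∃ hi : i + 1 < l.length, s(c, q) = s(l[i], l[i + 1])) →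
        (∃ i, ∃ hi : i + 1 < l.length, e = s(l[i], l[i + 1])) → IsPlanarGraph G) →
        c ≠ p → c ≠ q → p ≠ q →
        ∀ u v, e = s(u, v) → u ≠ c → v ≠ c → u ≠ v → u ≠ q → v ≠ q → IsPlanarGraph G := by
      intro p q aux hp hq hpq u v huv k1 k2 k3 k4 k5
      by_cases h1 : u = p
      · exact aux [v, p, c, q] (by grind) ⟨1, by simp, by simp [Sym2.eq_swap]⟩
          ⟨2, by simp, by simp⟩ ⟨0, by simp, by simp [huv, h1, Sym2.eq_swap]⟩
      by_cases h2 : v = p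
      · exact aux [u, p, c, q] (by grind) ⟨1, by simp, by simp [Sym2.eq_swap]⟩
          ⟨2, by simp, by simp⟩ ⟨0, by simp, by simp [huv, h2]⟩
      · exact aux [p, c, q, u, v] (by grind) ⟨0, by simp, by simp [Sym2.eq_swap]⟩
          ⟨1, by simp, by simp⟩ ⟨3, by simp, by simp [huv]⟩
    have heH := he
    rw [mem_edgeFinset] at heH
    induction e with | _ u v
    have huv : u ≠ v := H.ne_of_adj heH
    have hnd : [c, x, y].Nodup := by grind
    by_cases h1 : u = c
    · refine .inr ⟨hcard, c, x, y, s(u, v), hnd, hall, hcx, hcy, heH, ?_⟩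
      exact .inr ⟨v, by grind, by grind, by rw [h1]⟩
    by_cases h2 : v = c
    · refine .inr ⟨hcard, c, x, y, s(u, v), hnd, hall, hcx, hcy, heH, ?_⟩
      exact .inr ⟨u, by grind, by grind, by rw [h2, Sym2.eq_swap]⟩
    by_cases h3 : u ≠ y ∧ v ≠ y
    · exact .inl (aux' x y aux hncx hncy hxy u v rfl h1 h2 huv h3.1 h3.2)
    by_cases h4 : u ≠ x ∧ v ≠ x
    · exact .inl (aux' y x (fun l hl h1 h2 => aux l hl h2 h1) hncy hncx hxy.symm u v rfl h1 h2 huv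
        h4.1 h4.2)
    · refine .inr ⟨hcard, c, x, y, s(u, v), hnd, hall, hcx, hcy, heH, .inl ?_⟩
      rw [Sym2.eq_iff]; grind
  · push Not at h3
    refine .inl (isPlanarGraph_of_path G a b [x, c, y] (by grind) fun u v huv k1 k2 k3 k4 => ?_)
    have := h3 s(u, v) (by simpa using (hadj u v).2 ⟨huv, k1, k2, k3, k4⟩)
    by_cases h5 : s(u, v) = s(c, x)
    · exact ⟨0, by simp, by simp [h5, Sym2.eq_swap]⟩
    · exact ⟨1, by simp, by simp [this h5]⟩

/-- `K₃,₃` is the only graph with at most nine edges that is not planar. -/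
theorem isPlanarGraph_or_isThreeUtilities {V : Type*} [Fintype V] [DecidableEq V]
    (G : SimpleGraph V) [DecidableRel G.Adj] (h : G.edgeFinset.card ≤ 9) :
    IsPlanarGraph G ∨ ∃ a b c x y z, IsThreeUtilities G a b c x y z := by
  have three : ∀ (H : SimpleGraph V) [DecidableRel H.Adj] (v : V), 3 ≤ H.degree v →
      ∃ x y z, H.Adj v x ∧ H.Adj v y ∧ H.Adj v z ∧ x ≠ y ∧ x ≠ z ∧ y ≠ z := fun H _ v hv => by
    obtain ⟨x, y, z, hx, hy, hz, h⟩ := Finset.two_lt_card_iff.1 hv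
    exact ⟨x, y, z, by simpa using hx, by simpa using hy, by simpa using hz, h⟩
  rcases isEmpty_or_nonempty V with hV | hV
  · exact .inl (isPlanarGraph_of_two_page G (fun _ => 0) (fun u => hV.elim u) (fun _ => True)
      fun u => hV.elim u)
  obtain ⟨a, ha⟩ := G.exists_maximal_degree_vertex
  obtain ⟨b, hb⟩ := (G.deleteIncidenceSet a).exists_maximal_degree_vertex
  have hda : ∀ v, G.degree v ≤ G.degree a := fun v => ha ▸ G.degree_le_maxDegree v
  by_cases hb3 : 3 ≤ (G.deleteIncidenceSet a).degree b
  swap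
  · refine .inl (isPlanarGraph_of_deleteIncidenceSet G a fun u x y z hx hy hz => ?_)
    by_contra! hne
    refine hb3 (le_trans ?_ (hb ▸ (G.deleteIncidenceSet a).degree_le_maxDegree u))
    exact Finset.two_lt_card_iff.2 ⟨x, y, z, by simpa using hx, by simpa using hy,
      by simpa using hz, hne.1, hne.2.2, hne.2.1⟩
  have hba : b ≠ a := by
    obtain ⟨x, _, _, hx, _⟩ := three _ b hb3
    exact (deleteIncidenceSet_adj.1 hx).2.1
  have hdb : (G.deleteIncidenceSet a).degree b ≤ G.degree b :=
    degree_le_of_le (deleteIncidenceSet_le G a)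
  have h1 := G.card_edgeFinset_deleteIncidenceSet a
  have h2 := (G.deleteIncidenceSet a).card_edgeFinset_deleteIncidenceSet b
  have hab := hda b
  rcases isPlanarGraph_or_of_card_le_three G a b (by omega) with hpl |
    ⟨hcard, c, x, y, e, hcxy, hall, hcx, hcy, he, hcase⟩
  · exact .inl hpl
  have hfour : ∀ v p q r s, G.Adj v p → G.Adj v q → G.Adj v r → G.Adj v s →
      p ≠ q → p ≠ r → q ≠ r → s = p ∨ s = q ∨ s = r := fun v p q r s hp hq hr hs h1 h2 h3 => by
    refine exists_eq_of_card_le_three (s := G.neighborFinset v) ?_ (by simpa using hp)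
      (by simpa using hq) (by simpa using hr) (by simpa using hs) h1 h2 h3
    have := hda v
    rw [card_neighborFinset_eq_degree]
    omega
  simp only [deleteIncidenceSet_adj] at hcx hcy
  have hsymm := G.adj_comm
  rcases hcase with rfl | ⟨w, hwx, hwy, rfl⟩
  · left
    have hE : ∀ u v, G.Adj u v → u ≠ a → v ≠ a → u ≠ b → v ≠ b →
        s(u, v) = s(x, c) ∨ s(u, v) = s(c, y) ∨ s(u, v) = s(x, y) := fun u v h1 h2 h3 h4 h5 => by
      have := hall u v h1 h2 h3 h4 h5
      rwa [Sym2.eq_swap (a := x) (b := c)]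
    by_cases hac : G.Adj a c
    · refine isPlanarGraph_of_triangle G b a x c y (by grind) (by grind) (fun hbc => ?_)
        fun u v h1 h2 h3 h4 h5 => hE u v h1 h4 h5 h2 h3
      have := hfour c x y a b
      grind
    · exact isPlanarGraph_of_triangle G a b x c y (by grind) (by grind) hac hE
  · simp only [mem_edgeSet, deleteIncidenceSet_adj] at he
    obtain ⟨hxy, hcx', hcy'⟩ : x ≠ y ∧ c ≠ x ∧ c ≠ y := by
      simp only [List.nodup_cons, List.mem_cons, List.not_mem_nil] at hcxy; tauto
    have hcw := he.1.1.ne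
    rcases isPlanarGraph_or_of_claw G a b c x y w hcx' hcy' hcw hxy hwx.symm hwy.symm
      hall hcx.1.2.2 hcy.1.2.2 he.1.2.2 with hpl | ⟨hax, hay, haw⟩
    · exact .inl hpl
    rcases isPlanarGraph_or_of_claw G b a c x y w hcx' hcy' hcw hxy hwx.symm hwy.symm
      (fun u v h1 h2 h3 h4 h5 => hall u v h1 h4 h5 h2 h3) hcx.2.2 hcy.2.2 he.2.2 with hpl | ⟨hbx, hby, hbw⟩
    · exact .inl hpl
    have hS : ∀ u, u = a ∨ u = b ∨ u = c → G.Adj u x ∧ G.Adj u y ∧ G.Adj u w := by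
      rintro u (rfl | rfl | rfl)
      exacts [⟨hax, hay, haw⟩, ⟨hbx, hby, hbw⟩, ⟨hcx.1.1, hcy.1.1, he.1.1⟩]
    have key : ∀ u v, G.Adj u v → (u = a ∨ u = b ∨ u = c) → (v = x ∨ v = y ∨ v = w) :=
      fun u v huv hu => hfour u x y w v (hS u hu).1 (hS u hu).2.1 (hS u hu).2.2 huv
        hxy hwx.symm hwy.symm
    have hca := hcx.1.2.1
    have hcb := hcx.2.1
    have hxa := hcx.1.2.2
    have hya := hcy.1.2.2
    have hwa := he.1.2.2
    have hxb := hcx.2.2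
    have hyb := hcy.2.2
    have hwb := he.2.2
    refine .inr ⟨a, b, c, x, y, w, ?_, fun u v => ⟨fun huv => ?_, ?_⟩⟩
    · simp only [List.nodup_cons, List.mem_cons, List.not_mem_nil, List.nodup_nil]
      grind only
    · by_cases hu : u = a ∨ u = b ∨ u = c
      · exact .inl ⟨hu, key u v huv hu⟩
      by_cases hv : v = a ∨ v = b ∨ v = c
      · exact .inr ⟨key v u huv.symm hv, hv⟩
      push Not at hu hv
      have := hall u v huv hu.1 hv.1 hu.2.1 hv.2.1
      simp only [Sym2.eq_iff] at this
      tauto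
    · rintro (⟨hu, hv⟩ | ⟨hv, hu⟩)
      · rcases hv with rfl | rfl | rfl
        exacts [(hS u hu).1, (hS u hu).2.1, (hS u hu).2.2]
      · rcases hv with rfl | rfl | rfl
        exacts [(hS v hu).1.symm, (hS v hu).2.1.symm, (hS v hu).2.2.symm]

lemma isPlanarGraph_of_exchange_aux {V : Type*} [Finite V] {G H : SimpleGraph V}
    {a b c x y z p q : V} (hG : IsThreeUtilities G a b c x y z) (hpq : p ≠ q)
    (hpq' : ¬ G.Adj p q)
    (hH : ∀ u v, H.Adj u v → G.Adj u v ∧ s(u, v) ≠ s(a, x) ∨ s(u, v) = s(p, q)) :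
    IsPlanarGraph H := by
  obtain ⟨hnd, hadj⟩ := hG
  simp only [List.nodup_cons, List.mem_cons, List.not_mem_nil, List.nodup_nil, not_or,
    or_false, not_false_eq_true, and_true] at hnd
  obtain ⟨⟨hab, hac, hax, hay, haz⟩, ⟨hbc, hbx, hby, hbz⟩, ⟨hcx, hcy, hcz⟩, ⟨hxy, hxz⟩, hyz⟩ := hnd
  have hbc' : ∀ u v, H.Adj u v → u ≠ b → v ≠ b → u ≠ c → v ≠ c →
      s(u, v) = s(y, a) ∨ s(u, v) = s(a, z) ∨ s(u, v) = s(p, q) := by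
    intro u v huv h1 h2 h3 h4
    rcases hH u v huv with ⟨h5, h6⟩ | h5
    · rcases (hadj u v).1 h5 with ⟨h7, h8⟩ | ⟨h8, h7⟩
      · obtain rfl : u = a := by tauto
        rcases h8 with rfl | rfl | rfl
        exacts [absurd rfl h6, .inl Sym2.eq_swap, .inr (.inl rfl)]
      · obtain rfl : v = a := by tauto
        rcases h8 with rfl | rfl | rfl
        exacts [absurd Sym2.eq_swap h6, .inl rfl, .inr (.inl Sym2.eq_swap)]
    · exact .inr (.inr h5)
  have hyz' : ∀ u v, H.Adj u v → u ≠ y → v ≠ y → u ≠ z → v ≠ z →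
      s(u, v) = s(b, x) ∨ s(u, v) = s(x, c) ∨ s(u, v) = s(p, q) := by
    intro u v huv h1 h2 h3 h4
    rcases hH u v huv with ⟨h5, h6⟩ | h5
    · rcases (hadj u v).1 h5 with ⟨h7, h8⟩ | ⟨h8, h7⟩
      · obtain rfl : v = x := by tauto
        rcases h7 with rfl | rfl | rfl
        exacts [absurd rfl h6, .inl rfl, .inr (.inl Sym2.eq_swap)]
      · obtain rfl : u = x := by tauto
        rcases h7 with rfl | rfl | rfl
        exacts [absurd Sym2.eq_swap h6, .inl Sym2.eq_swap, .inr (.inl rfl)]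
    · exact .inr (.inr h5)
  clear hH
  wlog hw : p = a ∨ q ≠ a ∧ (p = y ∨ q ≠ y ∧ (p = z ∨ q ≠ z)) generalizing p q
  · refine this hpq.symm (fun h => hpq' h.symm) ?_ ?_ (by tauto)
    · rwa [Sym2.eq_swap (a := q)]
    · rwa [Sym2.eq_swap (a := q)]
  rw [hadj] at hpq'
  by_cases h1 : (p = b ∨ q = b) ∨ p = c ∨ q = c
  · refine isPlanarGraph_of_path H b c [y, a, z] (by simp; grind) fun u v h2 h3 h4 h5 h6 => ?_
    rcases hbc' u v h2 h3 h4 h5 h6 with h | h | h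
    · exact ⟨0, by simp, by simp [h]⟩
    · exact ⟨1, by simp, by simp [h]⟩
    · rw [Sym2.eq_iff] at h; grind
  by_cases h2 : p = a
  · refine isPlanarGraph_of_path H y z [b, x, c, a, q] (by simp; grind) fun u v h3 h4 h5 h6 h7 => ?_
    rcases hyz' u v h3 h4 h5 h6 h7 with h | h | h
    · exact ⟨0, by simp, by simp [h]⟩
    · exact ⟨1, by simp, by simp [h]⟩
    · exact ⟨3, by simp, by simp [h, h2]⟩
  by_cases h3 : (p = y ∨ p = z) ∧ (q = y ∨ q = z)
  · refine isPlanarGraph_of_path H y z [b, x, c] (by simp; grind) fun u v h4 h5 h6 h7 h8 => ?_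
    rcases hyz' u v h4 h5 h6 h7 h8 with h | h | h
    · exact ⟨0, by simp, by simp [h]⟩
    · exact ⟨1, by simp, by simp [h]⟩
    · rw [Sym2.eq_iff] at h; grind
  by_cases h4 : p = y
  · refine isPlanarGraph_of_path H b c [q, y, a, z] (by simp; grind) fun u v h5 h6 h7 h8 h9 => ?_
    rcases hbc' u v h5 h6 h7 h8 h9 with h | h | h
    · exact ⟨1, by simp, by simp [h]⟩
    · exact ⟨2, by simp, by simp [h]⟩
    · exact ⟨0, by simp, by simp [h, h4, Sym2.eq_swap]⟩
  by_cases h5 : p = z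
  · refine isPlanarGraph_of_path H b c [y, a, z, q] (by simp; grind)
      fun u v h6 h7 h8 h9 h10 => ?_
    rcases hbc' u v h6 h7 h8 h9 h10 with h | h | h
    · exact ⟨0, by simp, by simp [h]⟩
    · exact ⟨1, by simp, by simp [h]⟩
    · exact ⟨2, by simp, by simp [h, h5]⟩
  · refine isPlanarGraph_of_path H b c [y, a, z, p, q] (by simp; grind)
      fun u v h6 h7 h8 h9 h10 => ?_
    rcases hbc' u v h6 h7 h8 h9 h10 with h | h | h
    · exact ⟨0, by simp, by simp [h]⟩
    · exact ⟨1, by simp, by simp [h]⟩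
    · exact ⟨3, by simp, by simp [h]⟩

namespace IsThreeUtilities

variable {V : Type*} {G : SimpleGraph V} {a b c x y z : V}

lemma swap_left (h : IsThreeUtilities G a b c x y z) : IsThreeUtilities G b a c x y z :=
  ⟨by have := h.1; simp only [List.nodup_cons, List.mem_cons] at this ⊢; grind,
    fun u v => by rw [h.2]; tauto⟩

lemma rotate_left (h : IsThreeUtilities G a b c x y z) : IsThreeUtilities G c a b x y z :=
  ⟨by have := h.1; simp only [List.nodup_cons, List.mem_cons] at this ⊢; grind,
    fun u v => by rw [h.2]; tauto⟩

lemma flip (h : IsThreeUtilities G a b c x y z) : IsThreeUtilities G x y z a b c :=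
  ⟨by have := h.1; simp only [List.nodup_cons, List.mem_cons] at this ⊢; grind,
    fun u v => by rw [h.2]; tauto⟩

lemma nine_le_card [Fintype G.edgeSet] (h : IsThreeUtilities G a b c x y z) :
    9 ≤ G.edgeFinset.card := by
  classical
  obtain ⟨hnd, hadj⟩ := h
  simp only [List.nodup_cons, List.mem_cons, List.not_mem_nil, List.nodup_nil, not_or,
    or_false, not_false_eq_true, and_true] at hnd
  obtain ⟨⟨hab, hac, hax, hay, haz⟩, ⟨hbc, hbx, hby, hbz⟩, ⟨hcx, hcy, hcz⟩, ⟨hxy, hxz⟩, hyz⟩ := hnd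
  have h1 : ({a, b, c} : Finset V).card = 3 :=
    Finset.card_eq_three.2 ⟨a, b, c, hab, hac, hbc, rfl⟩
  have h2 : ({x, y, z} : Finset V).card = 3 :=
    Finset.card_eq_three.2 ⟨x, y, z, hxy, hxz, hyz, rfl⟩
  have h3 : (({a, b, c} : Finset V) ×ˢ ({x, y, z} : Finset V)).card = 9 := by
    rw [Finset.card_product, h1, h2]
  rw [← h3]
  refine Finset.card_le_card_of_injOn (fun p => s(p.1, p.2)) ?_ ?_
  · rintro ⟨u, v⟩ huv
    simp only [Finset.coe_product, Set.mem_prod, Finset.mem_coe, Finset.mem_insert,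
      Finset.mem_singleton] at huv
    simpa using (hadj u v).2 (.inl huv)
  · rintro ⟨u, v⟩ huv ⟨u', v'⟩ huv' heq
    simp only [Finset.coe_product, Set.mem_prod, Finset.mem_coe, Finset.mem_insert,
      Finset.mem_singleton] at huv huv'
    rcases Sym2.eq_iff.1 heq with ⟨rfl, rfl⟩ | ⟨rfl, rfl⟩
    · rfl
    · grind only

end IsThreeUtilities

/-- Moving an edge of `K₃,₃` to another place makes the graph planar. -/
theorem isPlanarGraph_of_exchange {V : Type*} [Finite V] {G H : SimpleGraph V}
    {a b c x y z : V} (hG : IsThreeUtilities G a b c x y z) {e f : Sym2 V} (he : e ∈ G.edgeSet)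
    (hf : f ∉ G.edgeSet) (hfd : ¬ f.IsDiag)
    (hH : ∀ g ∈ H.edgeSet, g ∈ G.edgeSet ∧ g ≠ e ∨ g = f) :
    IsPlanarGraph H := by
  induction e with | _ s t
  induction f with | _ p q
  have hH' : ∀ u v, H.Adj u v → G.Adj u v ∧ s(u, v) ≠ s(s, t) ∨ s(u, v) = s(p, q) :=
    fun u v huv => hH s(u, v) huv
  rw [mem_edgeSet] at he hf
  have hpq : p ≠ q := hfd
  wlog hst : (s = a ∨ s = b ∨ s = c) ∧ (t = x ∨ t = y ∨ t = z) generalizing s t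
  · refine this t s he.symm ?_ ?_ ?_
    · rwa [Sym2.eq_swap]
    · rwa [Sym2.eq_swap (a := t)]
    · exact (((hG.2 s t).1 he).resolve_left hst).symm
  wlog hs : s = a generalizing a b c
  · rcases hst.1 with h | h | h
    · exact absurd h hs
    · exact this hG.swap_left (by tauto) h
    · exact this hG.rotate_left (by tauto) h
  wlog ht : t = x generalizing x y z
  · rcases hst.2 with h | h | h
    · exact absurd h ht
    · exact this hG.flip.swap_left.flip (by tauto) h
    · exact this hG.flip.rotate_left.flip (by tauto) h
  subst hs ht
  exact isPlanarGraph_of_exchange_aux hG hpq hf hH'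

/-- The drawing of a subgraph induced by a drawing of a graph. -/
def Drawing.restrict {V : Type*} {G H : SimpleGraph V} (D : Drawing G) (h : H ≤ G) :
    Drawing H where
  pos := D.pos
  pos_inj := D.pos_inj
  arc _ _ e := D.arc (h e)
  arc_symm _ _ e := D.arc_symm (h e)
  arc_inj _ _ e := D.arc_inj (h e)
  arc_avoid _ _ e := D.arc_avoid (h e)

lemma Drawing.edgeInterior_restrict_subset {V : Type*} {G H : SimpleGraph V} (D : Drawing G)
    (h : H ≤ G) (e : Sym2 V) : (D.restrict h).edgeInterior e ⊆ D.edgeInterior e := by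
  intro p hp
  simp only [Drawing.edgeInterior, Set.mem_iUnion] at hp ⊢
  obtain ⟨u, v, huv, he, hp⟩ := hp
  exact ⟨u, v, h huv, he, hp⟩

lemma Drawing.isPlanarGraph_of_le {V : Type*} {G H : SimpleGraph V} (D : Drawing G) (h : H ≤ G)
    (hH : ∀ e ∈ H.edgeSet, ∀ f ∈ H.edgeSet, ¬ D.Crosses e f) : IsPlanarGraph H :=
  ⟨D.restrict h, fun e f ⟨he, hf, hne, hm⟩ => hH e he f hf
    ⟨edgeSet_mono h he, edgeSet_mono h hf, hne, hm.mono (Set.inter_subset_inter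
      (D.edgeInterior_restrict_subset h e) (D.edgeInterior_restrict_subset h f))⟩⟩

lemma IsPlanarGraph.crossingNumber_eq_zero {V : Type*} {G : SimpleGraph V}
    (h : IsPlanarGraph G) : crossingNumber G = 0 := by
  obtain ⟨D, hD⟩ := h
  exact Nat.sInf_eq_zero.2 (.inl ⟨D, by simp [Drawing.crossCount, hD]⟩)

lemma kCrossingNumber_two_eq_zero {V : Type*} {G G₁ G₂ : SimpleGraph V} (h : G₁ ⊔ G₂ = G)
    (hd : Disjoint G₁.edgeSet G₂.edgeSet) (h₁ : IsPlanarGraph G₁) (h₂ : IsPlanarGraph G₂) :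
    kCrossingNumber 2 G = 0 := by
  refine Nat.sInf_eq_zero.2 (.inl ⟨![G₁, G₂], ?_, ?_, ?_⟩)
  · rw [← h]
    apply le_antisymm
    · refine iSup_le fun i => ?_
      fin_cases i
      exacts [le_sup_left, le_sup_right]
    · exact sup_le (le_iSup ![G₁, G₂] 0) (le_iSup ![G₁, G₂] 1)
  · intro i j hij
    fin_cases i <;> fin_cases j
    exacts [absurd rfl hij, hd, hd.symm, absurd rfl hij]
  · simp [h₁.crossingNumber_eq_zero, h₂.crossingNumber_eq_zero]

/-- The graph on the edges of `G` in which crossing edges are adjacent. -/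
def Drawing.crossingGraph {V : Type*} {G : SimpleGraph V} (D : Drawing G) :
    SimpleGraph (Sym2 V) where
  Adj := D.Crosses
  symm := ⟨fun _ _ ⟨he, hf, hne, hm⟩ => ⟨hf, he, hne.symm, by rwa [Set.inter_comm]⟩⟩
  loopless := ⟨fun _ h => h.2.2.1 rfl⟩

lemma Drawing.card_edgeFinset_crossingGraph {V : Type*} [Fintype V] {G : SimpleGraph V}
    (D : Drawing G) [Fintype D.crossingGraph.edgeSet] :
    D.crossingGraph.edgeFinset.card = D.crossCount := by
  classical
  have h := D.crossingGraph.two_mul_card_edgeFinset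
  have h2 : {p : Sym2 V × Sym2 V | D.Crosses p.1 p.2} =
      (Finset.univ.filter fun (x, y) ↦ D.crossingGraph.Adj x y :
        Finset (Sym2 V × Sym2 V)) := by
    ext ⟨e, f⟩
    simp only [Finset.coe_filter, Finset.mem_univ, true_and]
    rfl
  rw [Drawing.crossCount, h2, Set.ncard_coe_finset, ← h]
  simp only [Nat.mul_div_cancel_left _ two_pos]
  convert rfl

lemma fromEdgeSet_le_of_subset_edgeSet {V : Type*} {G : SimpleGraph V} {S : Set (Sym2 V)}
    (hS : S ⊆ G.edgeSet) : fromEdgeSet S ≤ G := by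
  rw [← G.fromEdgeSet_edgeSet]
  exact fromEdgeSet_mono hS

lemma edgeSet_fromEdgeSet_of_subset {V : Type*} {G : SimpleGraph V} {S : Set (Sym2 V)}
    (hS : S ⊆ G.edgeSet) : (fromEdgeSet S).edgeSet = S := by
  rw [edgeSet_fromEdgeSet]
  exact sdiff_eq_left.2 (Set.disjoint_left.2 fun e he h => G.not_isDiag_of_mem_edgeSet (hS he) h)

lemma card_edgeFinset_fromEdgeSet_of_subset {V : Type*} {G : SimpleGraph V} {S : Finset (Sym2 V)}
    (hS : (S : Set (Sym2 V)) ⊆ G.edgeSet) [Fintype (fromEdgeSet (S : Set (Sym2 V))).edgeSet] :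
    (fromEdgeSet (S : Set (Sym2 V))).edgeFinset.card = S.card := by
  rw [← Set.ncard_coe_finset, coe_edgeFinset, edgeSet_fromEdgeSet_of_subset hS,
    Set.ncard_coe_finset]

/-- A set of edges meeting every crossing pair, if it forms a planar graph, witnesses that the
graph is biplanar. -/
lemma Drawing.kCrossingNumber_two_eq_zero_of_cover {V : Type*} {G : SimpleGraph V}
    (D : Drawing G) {S : Set (Sym2 V)} (hS : S ⊆ G.edgeSet)
    (hcov : ∀ e f, D.Crosses e f → e ∈ S ∨ f ∈ S) (hpl : IsPlanarGraph (fromEdgeSet S)) :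
    kCrossingNumber 2 G = 0 := by
  refine kCrossingNumber_two_eq_zero (G₁ := G \ fromEdgeSet S)
    (sdiff_sup_cancel (fromEdgeSet_le_of_subset_edgeSet hS)) ?_
    (D.isPlanarGraph_of_le sdiff_le fun e he f hf hc => ?_) hpl
  · rw [edgeSet_sdiff]
    exact disjoint_sdiff_self_left
  · rw [edgeSet_sdiff, edgeSet_fromEdgeSet_of_subset hS] at he hf
    exact (hcov e f hc).elim he.2 hf.2

section Cover

variable {W : Type*}

lemma exists_three_of_not_isAcyclic (C : SimpleGraph W) (h : ¬ C.IsAcyclic) :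
    ∃ a b c, a ≠ b ∧ a ≠ c ∧ b ≠ c ∧
      ∀ v, v = a ∨ v = b ∨ v = c → ∃ x y, x ≠ y ∧ C.Adj v x ∧ C.Adj v y := by
  simp only [IsAcyclic, not_forall, not_not] at h
  obtain ⟨v, p, hp⟩ := h
  have key : ∀ u ∈ p.support, ∃ x y, x ≠ y ∧ C.Adj u x ∧ C.Adj u y := by
    intro u hu
    obtain ⟨x, y, hxy, h⟩ := Set.ncard_eq_two.1 (hp.ncard_neighborSet_toSubgraph_eq_two hu)
    have hx : x ∈ p.toSubgraph.neighborSet u := by simp [h]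
    have hy : y ∈ p.toSubgraph.neighborSet u := by simp [h]
    exact ⟨x, y, hxy, hx.adj_sub, hy.adj_sub⟩
  have h3 := hp.three_le_length
  have hlen : p.support.tail.length = p.length := by simp
  have hnd := hp.support_nodup
  have hmem : ∀ u ∈ p.support.tail, u ∈ p.support := fun u => List.mem_of_mem_tail
  generalize p.support.tail = l at *
  match l, hlen with
  | a :: b :: c :: l, _ =>
    refine ⟨a, b, c, by grind, by grind, by grind, ?_⟩
    rintro v (rfl | rfl | rfl) <;> exact key _ (hmem _ (by simp))
  | [], h => simp at h; omega
  | [_], h => simp at h; omega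
  | [_, _], h => simp at h; omega

variable [Fintype W] [DecidableEq W]

/-- One endpoint of every edge not meeting `S`. -/
lemma exists_cover_of_not_incident (C : SimpleGraph W) [DecidableRel C.Adj] (S : Finset W)
    (T : Finset (Sym2 W)) (hT : T ⊆ C.edgeFinset) (hTS : ∀ e ∈ T, ∃ v ∈ S, v ∈ e) :
    ∃ R : Finset W, R.card + T.card ≤ C.edgeFinset.card ∧ Disjoint R S ∧
      (∀ v ∈ R, ∃ u, C.Adj v u) ∧ ∀ u v, C.Adj u v → u ∉ S → v ∉ S → u ∈ R ∨ v ∈ R := by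
  have hfst : ∀ e : Sym2 W, e.out.1 ∈ e := Sym2.out_fst_mem
  refine ⟨(C.edgeFinset.filter fun e => ∀ v ∈ S, v ∉ e).image fun e => e.out.1, ?_, ?_, ?_, ?_⟩
  · refine (Nat.add_le_add_right Finset.card_image_le _).trans ?_
    rw [← Finset.card_union_of_disjoint]
    · exact Finset.card_le_card (Finset.union_subset (Finset.filter_subset _ _) hT)
    · rw [Finset.disjoint_left]
      intro e he heT
      obtain ⟨v, hv, hve⟩ := hTS e heT
      exact (Finset.mem_filter.1 he).2 v hv hve
  · rw [Finset.disjoint_left]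
    intro v hv hvS
    obtain ⟨e, he, rfl⟩ := Finset.mem_image.1 hv
    exact (Finset.mem_filter.1 he).2 _ hvS (hfst e)
  · intro v hv
    obtain ⟨e, he, rfl⟩ := Finset.mem_image.1 hv
    obtain ⟨u, hu⟩ := hfst e
    have := (Finset.mem_filter.1 he).1
    refine ⟨u, ?_⟩
    rw [mem_edgeFinset] at this
    rw [← mem_edgeSet]
    exact hu ▸ this
  · intro u v huv hu hv
    have hmem : s(u, v) ∈ C.edgeFinset.filter fun e => ∀ v ∈ S, v ∉ e := by
      simp only [Finset.mem_filter, mem_edgeFinset, mem_edgeSet, Sym2.mem_iff]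
      refine ⟨huv, ?_⟩
      rintro w hw (rfl | rfl)
      exacts [hu hw, hv hw]
    rcases Sym2.mem_iff.1 (hfst s(u, v)) with h | h
    · exact .inl (Finset.mem_image.2 ⟨_, hmem, h⟩)
    · exact .inr (Finset.mem_image.2 ⟨_, hmem, h⟩)

/-- A graph with at most ten edges is bipartite, or has a small vertex cover, or has two vertex
covers of size at most nine that differ by an exchange. -/
theorem colorable_two_or_exists_cover (C : SimpleGraph W) [DecidableRel C.Adj]
    (h : C.edgeFinset.card ≤ 10) :
    C.Colorable 2 ∨
    (∃ S : Finset W, S.card ≤ 8 ∧ (∀ v ∈ S, ∃ u, C.Adj v u) ∧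
      ∀ u v, C.Adj u v → u ∈ S ∨ v ∈ S) ∨
    ∃ (S T : Finset W) (a c : W), S.card ≤ 9 ∧ (∀ v ∈ S, ∃ u, C.Adj v u) ∧
      (∀ u v, C.Adj u v → u ∈ S ∨ v ∈ S) ∧ (∀ v ∈ T, ∃ u, C.Adj v u) ∧
      (∀ u v, C.Adj u v → u ∈ T ∨ v ∈ T) ∧ a ∈ S ∧ c ∈ T ∧ c ∉ S ∧ ∀ v ∈ T, v ∈ S ∧ v ≠ a ∨ v = c := by
  by_cases hac : C.IsAcyclic
  · exact .inl hac.colorable_two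
  right
  obtain ⟨a, b, c, hab, hac, hbc, hdeg⟩ := exists_three_of_not_isAcyclic C hac
  have cover : ∀ (S : Finset W) (T : Finset (Sym2 W)), T ⊆ C.edgeFinset →
      (∀ e ∈ T, ∃ v ∈ S, v ∈ e) → S.card + 2 ≤ T.card → (∀ v ∈ S, ∃ u, C.Adj v u) →
      ∃ S : Finset W, S.card ≤ 8 ∧ (∀ v ∈ S, ∃ u, C.Adj v u) ∧
        ∀ u v, C.Adj u v → u ∈ S ∨ v ∈ S := by
    intro S T hT hTS hST hS
    obtain ⟨R, hR, -, hR', hcov⟩ := exists_cover_of_not_incident C S T hT hTS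
    refine ⟨S ∪ R, (Finset.card_union_le _ _).trans (by omega), fun v hv => ?_, fun u v huv => ?_⟩
    · exact (Finset.mem_union.1 hv).elim (hS v) (hR' v)
    · have := hcov u v huv
      simp only [Finset.mem_union]
      tauto
  by_cases h3 : ∃ v x y z, C.Adj v x ∧ C.Adj v y ∧ C.Adj v z ∧ x ≠ y ∧ x ≠ z ∧ y ≠ z
  · obtain ⟨v, x, y, z, hx, hy, hz, hxy, hxz, hyz⟩ := h3
    refine .inl (cover {v} {s(v, x), s(v, y), s(v, z)} ?_ ?_ ?_ ?_)
    · simp [Finset.insert_subset_iff, hx, hy, hz]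
    · simp
    · rw [Finset.card_eq_three.2 ⟨s(v, x), s(v, y), s(v, z), mt Sym2.congr_right.1 hxy,
        mt Sym2.congr_right.1 hxz, mt Sym2.congr_right.1 hyz, rfl⟩]
      simp
    · simpa using ⟨x, hx⟩
  have hpair : (∃ S : Finset W, S.card ≤ 8 ∧ (∀ v ∈ S, ∃ u, C.Adj v u) ∧
      ∀ u v, C.Adj u v → u ∈ S ∨ v ∈ S) ∨
      ∀ u v, (u = a ∨ u = b ∨ u = c) → (v = a ∨ v = b ∨ v = c) → u ≠ v → C.Adj u v := by
    by_contra! hcon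
    obtain ⟨hcon, u, v, hu, hv, huv, hadj⟩ := hcon
    obtain ⟨x, y, hxy, hx, hy⟩ := hdeg u hu
    obtain ⟨p, q, hpq, hp, hq⟩ := hdeg v hv
    obtain ⟨S, h1, h2, h3⟩ := cover {u, v} ({s(u, x), s(u, y)} ∪ {s(v, p), s(v, q)})
      (by simp [Finset.insert_subset_iff, hx, hy, hp, hq])
      (by simp) (by
        rw [Finset.card_union_of_disjoint, Finset.card_pair huv,
          Finset.card_pair (mt Sym2.congr_right.1 hxy), Finset.card_pair (mt Sym2.congr_right.1 hpq)]
        rw [Finset.disjoint_left]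
        intro e he he'
        simp only [Finset.mem_insert, Finset.mem_singleton] at he he'
        have : u ∈ e := by rcases he with rfl | rfl <;> simp
        rcases he' with rfl | rfl <;> rw [Sym2.mem_iff] at this <;>
          rcases this with rfl | rfl <;> first | exact huv rfl | exact hadj (C.adj_symm ‹_›))
      (by simpa using ⟨⟨x, hx⟩, ⟨p, hp⟩⟩)
    obtain ⟨s, t, hst, hs, ht⟩ := hcon S h1 h2
    exact (h3 s t hst).elim hs ht
  rcases hpair with hS | hpair
  · exact .inl hS
  right
  have hab' : C.Adj a b := hpair a b (by simp) (by simp) hab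
  have hac' : C.Adj a c := hpair a c (by simp) (by simp) hac
  have hbc' : C.Adj b c := hpair b c (by simp) (by simp) hbc
  have hthree : ∀ v x y z, C.Adj v x → C.Adj v y → C.Adj v z → x ≠ y → z = x ∨ z = y := by
    intro v x y z hx hy hz hxy
    by_contra! hne
    exact h3 ⟨v, x, y, z, hx, hy, hz, hxy, hne.1.symm, hne.2.symm⟩
  obtain ⟨R, hR, hdisj, hR', hcov⟩ := exists_cover_of_not_incident C {a, b, c}
    {s(a, b), s(a, c), s(b, c)} (by simp [Finset.insert_subset_iff, hab', hac', hbc']) (by simp)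
  rw [Finset.card_eq_three.2 ⟨s(a, b), s(a, c), s(b, c), mt Sym2.congr_right.1 hbc,
    by simp; grind, by simp; grind, rfl⟩] at hR
  have haR : a ∉ R := fun h => Finset.disjoint_left.1 hdisj h (by simp)
  have hcR : c ∉ R := fun h => Finset.disjoint_left.1 hdisj h (by simp)
  simp only [Finset.mem_insert, Finset.mem_singleton, not_or] at hcov
  have hsupp : ∀ v, v = a ∨ v = b ∨ v = c ∨ v ∈ R → ∃ u, C.Adj v u := by
    rintro v (rfl | rfl | rfl | h)
    exacts [⟨b, hab'⟩, ⟨c, hbc'⟩, ⟨b, hbc'.symm⟩, hR' v h]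
  have hca : ∀ v, C.Adj a v → v = b ∨ v = c := fun v hv => hthree a b c v hab' hac' hv hbc
  have hcc : ∀ v, C.Adj c v → v = a ∨ v = b := fun v hv =>
    hthree c a b v hac'.symm hbc'.symm hv hab
  refine ⟨insert a (insert b R), insert b (insert c R), a, c, ?_, fun v hv => ?_, fun u v huv => ?_,
    fun v hv => ?_, fun u v huv => ?_, by simp, by simp, ?_, fun v hv => ?_⟩
  · have h1 := Finset.card_insert_le a (insert b R)
    have h2 := Finset.card_insert_le b R
    omega
  · simp only [Finset.mem_insert] at hv
    exact hsupp v (by tauto)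
  · have h1 := hcov u v huv
    simp only [Finset.mem_insert]
    by_cases hu : u = c
    · have := hcc v (hu ▸ huv)
      tauto
    by_cases hv : v = c
    · have := hcc u (hv ▸ huv.symm)
      tauto
    tauto
  · simp only [Finset.mem_insert] at hv
    exact hsupp v (by tauto)
  · have h1 := hcov u v huv
    simp only [Finset.mem_insert]
    by_cases hu : u = a
    · have := hca v (hu ▸ huv)
      tauto
    by_cases hv : v = a
    · have := hca u (hv ▸ huv.symm)
      tauto
    tauto
  · simp [hac.symm, hbc.symm, hcR]
  · simp only [Finset.mem_insert] at hv ⊢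
    rcases hv with rfl | rfl | hv
    · exact .inl ⟨by simp, hab.symm⟩
    · exact .inr rfl
    · exact .inl ⟨by simp [hv], fun h => haR (h ▸ hv)⟩

end Cover

lemma exists_crossCount_eq_crossingNumber {V : Type*} [Finite V] (G : SimpleGraph V) :
    ∃ D : Drawing G, D.crossCount = crossingNumber G := by
  obtain ⟨n, ⟨e⟩⟩ := Finite.exists_equiv_fin V
  have hf : Function.Injective fun v => ((e v : ℕ) : ℝ) :=
    fun u v h => e.injective (Fin.ext (Nat.cast_injective h))
  have : {n : ℕ | ∃ D : Drawing G, D.crossCount = n}.Nonempty :=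
    ⟨_, parabolaDrawing G _ hf (fun _ => 1) (fun _ => one_ne_zero), rfl⟩
  exact Nat.sInf_mem this

/-- Every simple graph `G` with `cr(G) ≤ 10` is biplanar, i.e. `cr₂(G) = 0`. -/
theorem cr_le_ten_implies_biplanar {V : Type} [Fintype V] (G : SimpleGraph V)
    (h : crossingNumber G ≤ 10) : kCrossingNumber 2 G = 0 := by
  classical
  obtain ⟨D, hD⟩ := exists_crossCount_eq_crossingNumber G
  have hedge : ∀ S : Finset (Sym2 V), (∀ e ∈ S, ∃ f, D.crossingGraph.Adj e f) →
      (S : Set (Sym2 V)) ⊆ G.edgeSet := fun S hS e he => (hS e he).choose_spec.1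
  have hcard : ∀ S : Finset (Sym2 V), (S : Set (Sym2 V)) ⊆ G.edgeSet → S.card ≤ 9 →
      ∀ _ : Fintype (fromEdgeSet (S : Set (Sym2 V))).edgeSet,
        (fromEdgeSet (S : Set (Sym2 V))).edgeFinset.card ≤ 9 := fun S hSG hS inst => by
    rwa [@card_edgeFinset_fromEdgeSet_of_subset V G S hSG inst]
  rcases colorable_two_or_exists_cover D.crossingGraph
    (by rw [D.card_edgeFinset_crossingGraph, hD]; exact h) with ⟨⟨col⟩⟩ |
    ⟨S, hS, hsupp, hcov⟩ | ⟨S, T, a, c, hS, hSsupp, hScov, hTsupp, hTcov, ha, hcT, hc, hST⟩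
  · have hsub : {e | e ∈ G.edgeSet ∧ col e = 0} ⊆ G.edgeSet := fun e he => he.1
    refine D.kCrossingNumber_two_eq_zero_of_cover hsub (fun e f hef => ?_)
      (D.isPlanarGraph_of_le (fromEdgeSet_le_of_subset_edgeSet hsub) fun e he f hf hef => ?_)
    · have : col e ≠ col f := col.valid hef
      simp only [Set.mem_ofPred_eq, hef.1, hef.2.1, true_and]
      omega
    · rw [edgeSet_fromEdgeSet_of_subset hsub] at he hf
      exact col.valid (show D.crossingGraph.Adj e f from hef) (he.2.trans hf.2.symm)
  · have hSG := hedge S hsupp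
    refine D.kCrossingNumber_two_eq_zero_of_cover hSG hcov ?_
    refine (isPlanarGraph_or_isThreeUtilities (fromEdgeSet (S : Set (Sym2 V)))
      (hcard S hSG (by omega) _)).resolve_right ?_
    rintro ⟨a, b, c, x, y, z, hK⟩
    have := hK.nine_le_card
    rw [card_edgeFinset_fromEdgeSet_of_subset hSG] at this
    omega
  · have hSG := hedge S hSsupp
    have hTG := hedge T hTsupp
    rcases isPlanarGraph_or_isThreeUtilities (fromEdgeSet (S : Set (Sym2 V)))
      (hcard S hSG hS _) with hpl | ⟨a', b', c', x, y, z, hK⟩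
    · exact D.kCrossingNumber_two_eq_zero_of_cover hSG hScov hpl
    refine D.kCrossingNumber_two_eq_zero_of_cover hTG hTcov
      (isPlanarGraph_of_exchange hK (e := a) (f := c) ?_ ?_ ?_ ?_)
    · rwa [edgeSet_fromEdgeSet_of_subset hSG]
    · rwa [edgeSet_fromEdgeSet_of_subset hSG]
    · exact G.not_isDiag_of_mem_edgeSet (hTG hcT)
    · rw [edgeSet_fromEdgeSet_of_subset hSG, edgeSet_fromEdgeSet_of_subset hTG]
      exact hST
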